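/- Let u be a partition with w(u) = n and set ṅ = n − u_1 − 3u_3, and assume ṅ > 0. If ṅ = 7u_7, i.e. u_i = 0 for all i ∉ {1, 3, 7}, then v_2(τ_u) ≥ u_3 + ⌈ṅ/2⌉ − 3; otherwise v_2(τ_u) ≥ u_3 + ⌈ṅ/2⌉ − 1. -/

import Mathlib

open Finsupp MvPolynomial

noncomputable section

/-- weight of a partition (given as the multiplicity function of its parts) -/
def wt (u : ℕ →₀ ℕ) : ℕ := u.sum fun i m => i * m

/-- degree (number of parts) -/
def deg (u : ℕ →₀ ℕ) : ℕ := u.sum fun _ m => m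

/-- γ_u = Π_i (i+1)^{u_i} (u_i)! -/
def gam (u : ℕ →₀ ℕ) : ℕ := u.prod fun i m => (i + 1) ^ m * m.factorial

/-- τ_u = (−1)^{d(u)−1} (w(u)+d(u)−2)! / γ_u -/
def tau (u : ℕ →₀ ℕ) : ℚ :=
  (-1 : ℚ) ^ (deg u - 1) * (Nat.factorial (wt u + deg u - 2) : ℚ) / (gam u : ℚ)

/-- p-adic valuation on ℚ with v_p(0) = ⊤ -/
def pval (p : ℕ) (x : ℚ) : WithTop ℤ :=
  if x = 0 then ⊤ else ((padicValRat p x : ℤ) : WithTop ℤ)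

/-- the 2-adic valuation of `n!` -/
def factVal (n : ℕ) : ℕ := padicValNat 2 n.factorial

/-- the 2-adic valuation of the factor of `gam` coming from `k` parts equal to `i` -/
def gamVal (i k : ℕ) : ℕ := padicValNat 2 ((i + 1) ^ k * k.factorial)

lemma gamVal_eq (i k : ℕ) : gamVal i k = k * padicValNat 2 (i + 1) + factVal k := by
  rw [gamVal, factVal, padicValNat.mul (by positivity) (by positivity), padicValNat.pow]

lemma factVal_add_le (a b : ℕ) : factVal a + factVal b ≤ factVal (a + b) := by
  rw [factVal, factVal, ← padicValNat.mul (by positivity) (by positivity)]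
  exact (padicValNat_dvd_iff_le (by positivity)).1
    (pow_padicValNat_dvd.trans (Nat.factorial_mul_factorial_dvd_factorial_add a b))

lemma sum_factVal_le (s : Finset ℕ) (f : ℕ → ℕ) :
    ∑ i ∈ s, factVal (f i) ≤ factVal (∑ i ∈ s, f i) := by
  induction s using Finset.induction_on with
  | empty => simp
  | insert a s ha ih =>
    rw [Finset.sum_insert ha, Finset.sum_insert ha]
    exact (Nat.add_le_add_left ih _).trans (factVal_add_le _ _)

lemma factVal_two_mul (k : ℕ) : factVal (2 * k) = factVal k + k :=
  padicValNat_factorial_mul k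

lemma factVal_two_pow_mul (e k : ℕ) : factVal (2 ^ e * k) + k = 2 ^ e * k + factVal k := by
  induction e with
  | zero => simp [add_comm]
  | succ e ih =>
    rw [pow_succ', mul_assoc, factVal_two_mul]
    omega

lemma factVal_sub_two {N : ℕ} (hN : 2 ≤ N) (h : Even N) :
    factVal N = factVal (N - 2) + padicValNat 2 N := by
  obtain ⟨M, rfl⟩ := Nat.exists_eq_add_of_le' hN
  have hodd : padicValNat 2 (M + 1) = 0 :=
    padicValNat.eq_zero_of_not_dvd (by
      have := h.two_dvd
      omega)
  rw [factVal, factVal, Nat.add_sub_cancel, Nat.factorial_succ, Nat.factorial_succ,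
    padicValNat.mul (by positivity) (by positivity),
    padicValNat.mul (by positivity) (by positivity), hodd]
  ring

lemma two_mul_padicValNat_two_le {k : ℕ} (hk : 0 < k) : 2 * padicValNat 2 k ≤ k := by
  have h1 : 2 ^ padicValNat 2 k ≤ k := Nat.le_of_dvd hk pow_padicValNat_dvd
  have h2 : ∀ v : ℕ, 2 * v ≤ 2 ^ v := by
    intro v
    induction v with
    | zero => simp
    | succ v ih =>
      have := Nat.one_le_two_pow (n := v)
      rcases v with _ | v
      · simp
      · rw [pow_succ]
        omega
  exact (h2 _).trans h1

lemma padicValNat_two_pow_mul_odd (e r : ℕ) : padicValNat 2 (2 ^ e * (2 * r + 1)) = e := by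
  rw [padicValNat.mul (by positivity) (by positivity), padicValNat.prime_pow,
    padicValNat.eq_zero_of_not_dvd (n := 2 * r + 1) (by omega), add_zero]

lemma factVal_odd_mul_ge (r k : ℕ) : factVal k + r * k ≤ factVal ((2 * r + 1) * k) := by
  have h := factVal_add_le k (2 * (r * k))
  rw [factVal_two_mul] at h
  rw [show (2 * r + 1) * k = k + 2 * (r * k) by ring]
  omega

lemma eq_two_pow_mul_odd (i : ℕ) : ∃ e r : ℕ, i + 1 = 2 ^ e * (2 * r + 1) := by
  obtain ⟨e, m, ⟨r, rfl⟩, h⟩ := Nat.exists_eq_two_pow_mul_odd (n := i + 1) (by omega)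
  exact ⟨e, r, h⟩

lemma four_mul_le_two_pow {e : ℕ} (he : 4 ≤ e) : 4 * e ≤ 2 ^ e := by
  induction e, he using Nat.le_induction with
  | base => norm_num
  | succ e he ih =>
    rw [pow_succ]
    omega

lemma gamVal_add_le {i : ℕ} (h1 : i ≠ 1) (h3 : i ≠ 3) (k : ℕ) :
    2 * gamVal i k + i * k ≤ 2 * factVal ((i + 1) * k) := by
  obtain ⟨e, r, h⟩ := eq_two_pow_mul_odd i
  have hg := gamVal_eq i k
  rw [h, padicValNat_two_pow_mul_odd] at hg
  have hA := factVal_odd_mul_ge r k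
  have hP := factVal_two_pow_mul e ((2 * r + 1) * k)
  rw [← mul_assoc, ← h] at hP
  have key : 2 * e + (2 * r + 1) ≤ i + 1 := by
    match e, h with
    | 0, h => simp at h; omega
    | 1, h => omega
    | 2, h => omega
    | 3, h => omega
    | e + 4, h =>
      have := four_mul_le_two_pow (e := e + 4) (by omega)
      rw [h]
      nlinarith
  have := Nat.mul_le_mul_right k key
  nlinarith

lemma gamVal_add_le_of_even {i e r k c : ℕ} (h : i + 1 = 2 ^ e * (2 * r + 1)) (he : e ≠ 0)
    (hk : 0 < k) (hc : 2 * e * k + (2 * r + 1) * k + 2 * e + k ≤ (i + 1) * k + c) :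
    2 * gamVal i k + i * k ≤ 2 * factVal ((i + 1) * k - 2) + c := by
  have hg := gamVal_eq i k
  rw [h, padicValNat_two_pow_mul_odd] at hg
  have hA := factVal_odd_mul_ge r k
  have hP := factVal_two_pow_mul e ((2 * r + 1) * k)
  rw [← mul_assoc, ← h] at hP
  have hv : padicValNat 2 ((i + 1) * k) = e + padicValNat 2 k := by
    rw [padicValNat.mul (by positivity) (by positivity), h, padicValNat_two_pow_mul_odd]
  have hev : Even ((i + 1) * k) := by
    rw [h]
    exact ((even_two.pow_of_ne_zero he).mul_right _).mul_right _
  have hs := factVal_sub_two (Nat.le_of_dvd (by positivity) hev.two_dvd) hev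
  have hV := two_mul_padicValNat_two_le hk
  nlinarith

lemma gamVal_add_le_sub_two {i k : ℕ} (h0 : i ≠ 0) (h1 : i ≠ 1) (h3 : i ≠ 3) (h7 : i ≠ 7)
    (hk : 0 < k) : 2 * gamVal i k + i * k ≤ 2 * factVal ((i + 1) * k - 2) + 2 := by
  obtain ⟨e, r, h⟩ := eq_two_pow_mul_odd i
  rcases eq_or_ne e 0 with rfl | he
  · have hg := gamVal_eq i k
    rw [h, padicValNat_two_pow_mul_odd] at hg
    have hr : 1 ≤ r := by
      simp at h
      omega
    have hrk : 1 ≤ r * k := Nat.mul_pos hr hk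
    have hi : i = 2 * r := by
      simp at h
      exact h
    have h2 := factVal_add_le k (2 * (r * k - 1))
    rw [factVal_two_mul] at h2
    have hN : (i + 1) * k - 2 = k + 2 * (r * k - 1) := by
      rw [hi, show (2 * r + 1) * k = k + 2 * (r * k) by ring]
      omega
    have hik : i * k = 2 * (r * k) := by rw [hi]; ring
    rw [hN]
    omega
  · refine gamVal_add_le_of_even h he hk ?_
    have key : 4 * e + (2 * r + 1) ≤ i + 2 := by
      match e, h with
      | 0, h => exact absurd rfl he
      | 1, h => omega
      | 2, h => omega
      | 3, h => omega
      | e + 4, h =>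
        have := four_mul_le_two_pow (e := e + 4) (by omega)
        have : 4 * (e + 4) * (2 * r + 1) ≤ i + 1 := h ▸ Nat.mul_le_mul_right _ this
        nlinarith
    obtain ⟨k, rfl⟩ := Nat.exists_eq_add_of_le' hk
    obtain ⟨d, hd⟩ := Nat.exists_eq_add_of_le key
    have he' : 1 ≤ e := Nat.one_le_iff_ne_zero.2 he
    have hi : i + 1 = 4 * e + 2 * r + d := by omega
    rw [hi]
    nlinarith [Nat.mul_le_mul_right k he']

lemma gamVal_seven_add_le {k : ℕ} (hk : 0 < k) :
    2 * gamVal 7 k + 7 * k ≤ 2 * factVal ((7 + 1) * k - 2) + 6 :=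
  gamVal_add_le_of_even (e := 3) (r := 0) (by norm_num) (by norm_num) hk (by omega)

/-- the contribution of `k` parts equal to `i` to twice the lower bound -/
def gain (i k : ℕ) : ℕ := if i = 1 then 0 else if i = 3 then 2 * k else i * k

lemma gamVal_add_gain_le (i k : ℕ) : 2 * gamVal i k + gain i k ≤ 2 * factVal ((i + 1) * k) := by
  unfold gain
  split_ifs with h1 h3
  · subst h1
    have hg := gamVal_eq 1 k
    have := padicValNat_two_pow_mul_odd 1 0
    norm_num at this hg ⊢
    rw [factVal_two_mul]
    omega
  · subst h3
    have hg := gamVal_eq 3 k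
    have := padicValNat_two_pow_mul_odd 2 0
    norm_num at this
    norm_num [this] at hg ⊢
    have := factVal_two_pow_mul 2 k
    norm_num at this
    omega
  · exact gamVal_add_le h1 h3 k

lemma wt_add_deg (u : ℕ →₀ ℕ) : wt u + deg u = ∑ i ∈ u.support, (i + 1) * u i := by
  rw [wt, deg, Finsupp.sum, Finsupp.sum, ← Finset.sum_add_distrib]
  exact Finset.sum_congr rfl fun i _ => by ring

lemma gam_ne_zero (u : ℕ →₀ ℕ) : gam u ≠ 0 :=
  Finset.prod_ne_zero_iff.2 fun i _ => by positivity

lemma padicValNat_gam (u : ℕ →₀ ℕ) :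
    padicValNat 2 (gam u) = ∑ i ∈ u.support, gamVal i (u i) := by
  rw [gam, Finsupp.prod]
  generalize u.support = s
  induction s using Finset.induction_on with
  | empty => simp
  | insert a s ha ih =>
    rw [Finset.prod_insert ha, Finset.sum_insert ha, padicValNat.mul (by positivity)
      (Finset.prod_ne_zero_iff.2 fun i _ => by positivity), ih, gamVal]

lemma sum_gain (u : ℕ →₀ ℕ) : ∑ i ∈ u.support, gain i (u i) + u 1 + u 3 = wt u := by
  have h1 : ∑ i ∈ u.support, (if i = 1 then u i else 0) = u 1 := by
    simp +contextual [Finset.sum_ite_eq', eq_comm]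
  have h3 : ∑ i ∈ u.support, (if i = 3 then u i else 0) = u 3 := by
    simp +contextual [Finset.sum_ite_eq', eq_comm]
  rw [wt, Finsupp.sum, ← h1, ← h3, ← Finset.sum_add_distrib, ← Finset.sum_add_distrib]
  refine Finset.sum_congr rfl fun i _ => ?_
  unfold gain
  split_ifs <;> first | omega | (subst_vars; omega)

lemma wt_eq_of_support {u : ℕ →₀ ℕ} (h : ∀ i ∈ u.support, i = 1 ∨ i = 3 ∨ i = 7) :
    wt u = u 1 + 3 * u 3 + 7 * u 7 := by
  have hs : u.support ⊆ {1, 3, 7} := fun i hi => by simpa using h i hi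
  rw [wt, Finsupp.sum_of_support_subset u hs _ (by simp)]
  simp
  ring

lemma gam_val_add_gain_le {u : ℕ →₀ ℕ} {j c : ℕ} (hj : j ∈ u.support) (h1 : 1 ≤ j)
    (hg : gain j (u j) = j * u j)
    (hc : 2 * gamVal j (u j) + j * u j ≤ 2 * factVal ((j + 1) * u j - 2) + c) :
    2 * padicValNat 2 (gam u) + ∑ i ∈ u.support, gain i (u i)
      ≤ 2 * factVal (wt u + deg u - 2) + c := by
  have huj : 1 ≤ u j := Nat.one_le_iff_ne_zero.2 (Finsupp.mem_support_iff.1 hj)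
  have h2 : 2 ≤ (j + 1) * u j := by nlinarith
  rw [padicValNat_gam, wt_add_deg, ← Finset.add_sum_erase _ _ hj, ← Finset.add_sum_erase _ _ hj,
    ← Finset.add_sum_erase _ _ hj, Nat.sub_add_comm h2]
  have hs := sum_factVal_le (u.support.erase j) fun i => (i + 1) * u i
  have ha := factVal_add_le ((j + 1) * u j - 2) (∑ i ∈ u.support.erase j, (i + 1) * u i)
  have hsum := Finset.sum_le_sum fun i (_ : i ∈ u.support.erase j) => gamVal_add_gain_le i (u i)
  rw [Finset.sum_add_distrib, ← Finset.mul_sum, ← Finset.mul_sum] at hsum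
  omega

lemma pval_tau (u : ℕ →₀ ℕ) :
    pval 2 (tau u)
      = (((factVal (wt u + deg u - 2) : ℤ) - (padicValNat 2 (gam u) : ℤ) : ℤ) : WithTop ℤ) := by
  have hf : ((wt u + deg u - 2).factorial : ℚ) ≠ 0 := by positivity
  have hg : (gam u : ℚ) ≠ 0 := Nat.cast_ne_zero.2 (gam_ne_zero u)
  have hs : ((-1 : ℚ) ^ (deg u - 1)) ≠ 0 := by simp
  have hv : padicValRat 2 ((-1 : ℚ) ^ (deg u - 1)) = 0 := by
    rcases neg_one_pow_eq_or ℚ (deg u - 1) with h | h <;> simp [h]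
  rw [pval, tau, if_neg (div_ne_zero (mul_ne_zero hs hf) hg),
    padicValRat.div (mul_ne_zero hs hf) hg, padicValRat.mul hs hf, hv, padicValRat.of_nat, padicValRat.of_nat, factVal, zero_add]

/-- with ṅ = n − u_1 − 3u_3 > 0, one has
v_2(τ_u) ≥ u_3 + ⌈ṅ/2⌉ − 3 when ṅ = 7u_7 (i.e. u_i = 0 for i ∉ {1,3,7}), and
v_2(τ_u) ≥ u_3 + ⌈ṅ/2⌉ − 1 otherwise. -/
theorem stmt_14 (u : ℕ →₀ ℕ) (hu0 : u 0 = 0) (n : ℕ) (hw : wt u = n)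
    (ndot : ℕ) (hndot : ndot = n - (u 1 + 3 * u 3)) (hpos : 0 < ndot) :
    (ndot = 7 * u 7 →
      (((u 3 : ℤ) + ((ndot + 1) / 2 : ℕ) - 3 : ℤ) : WithTop ℤ) ≤ pval 2 (tau u))
    ∧ (ndot ≠ 7 * u 7 →
      (((u 3 : ℤ) + ((ndot + 1) / 2 : ℕ) - 1 : ℤ) : WithTop ℤ) ≤ pval 2 (tau u)) := by
  have hgain := sum_gain u
  rw [pval_tau, WithTop.coe_le_coe, WithTop.coe_le_coe]
  constructor
  · intro h
    have h7 : 0 < u 7 := by omega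
    have := gam_val_add_gain_le (u := u) (j := 7) (Finsupp.mem_support_iff.2 h7.ne') (by norm_num)
      (by simp [gain]) (gamVal_seven_add_le h7)
    omega
  · intro h
    obtain ⟨j, hj, hne⟩ : ∃ j ∈ u.support, ¬(j = 1 ∨ j = 3 ∨ j = 7) := by
      by_contra! hall
      have := wt_eq_of_support hall
      omega
    push Not at hne
    obtain ⟨h1, h3, h7⟩ := hne
    have huj : u j ≠ 0 := Finsupp.mem_support_iff.1 hj
    have h0 : j ≠ 0 := fun h => huj (h ▸ hu0)
    have := gam_val_add_gain_le hj (Nat.one_le_iff_ne_zero.2 h0) (by simp [gain, h1, h3])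
      (gamVal_add_le_sub_two h0 h1 h3 h7 (Nat.pos_of_ne_zero huj))
    omega

end
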